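/- In any generalized quitting game, if a closed convex set C ⊆ ℝ^d satisfies Condition (1), then C is weakly approachable by player 1. -/

import Mathlib

open scoped BigOperators

noncomputable section

/-- A generalized quitting game: finite action sets `I` (player 1) and `J` (player 2),
each partitioned into non-quitting and quitting actions via the Boolean predicates
`Istar`, `Jstar` (`true` = quitting), and a vector payoff function `g`. -/
structure GQGame (I J : Type) (d : ℕ) where
  Istar : I → Bool
  Jstar : J → Bool
  g : I → J → EuclideanSpace ℝ (Fin d)

namespace GQGame

variable {I J : Type} {d : ℕ} [Fintype I] [Fintype J]

/-- Multilinear extension of the payoff function. -/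
def mix (G : GQGame I J d) (x : I → ℝ) (y : J → ℝ) : EuclideanSpace ℝ (Fin d) :=
  ∑ i, ∑ j, (x i * y j) • G.g i j

/-- Linear extension of the payoff against a fixed pure action `j` of player 2. -/
def mixL (G : GQGame I J d) (x : I → ℝ) (j : J) : EuclideanSpace ℝ (Fin d) :=
  ∑ i, x i • G.g i j

/-- Measure of absorption `p*`. -/
def pstar (G : GQGame I J d) (α : I → ℝ) (β : J → ℝ) : ℝ :=
  ∑ i, ∑ j, if G.Istar i || G.Jstar j then α i * β j else 0

/-- Expected absorption payoff `g*`. -/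
def gstar (G : GQGame I J d) (α : I → ℝ) (β : J → ℝ) : EuclideanSpace ℝ (Fin d) :=
  ∑ i, ∑ j, if G.Istar i || G.Jstar j then (α i * β j) • G.g i j else 0

/-- The function φ(x,α,y,β) appearing in the approachability conditions. -/
def phi (G : GQGame I J d) (x α : I → ℝ) (y β : J → ℝ) : EuclideanSpace ℝ (Fin d) :=
  (1 + G.pstar α y + G.pstar x β)⁻¹ • (G.mix x y + G.gstar α y + G.gstar x β)

/-- The value featuring in Condition (1):
`max_y min_x inf_α sup_β d_C(φ(x,α,y,β))`. -/
def cond1Val (G : GQGame I J d) (C : Set (EuclideanSpace ℝ (Fin d))) : ℝ :=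
  ⨆ y : stdSimplex ℝ J, ⨅ x : stdSimplex ℝ I,
    ⨅ α : {a : I → ℝ // ∀ i, 0 ≤ a i}, ⨆ β : {b : J → ℝ // ∀ j, 0 ≤ b j},
      Metric.infDist (G.phi x.1 α.1 y.1 β.1) C

/-- The value featuring in Condition (2):
`max_y min_x sup_β inf_α d_C(φ(x,α,y,β))`. -/
def cond2Val (G : GQGame I J d) (C : Set (EuclideanSpace ℝ (Fin d))) : ℝ :=
  ⨆ y : stdSimplex ℝ J, ⨅ x : stdSimplex ℝ I,
    ⨆ β : {b : J → ℝ // ∀ j, 0 ≤ b j}, ⨅ α : {a : I → ℝ // ∀ i, 0 ≤ a i},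
      Metric.infDist (G.phi x.1 α.1 y.1 β.1) C

/-- The value featuring in Condition (3):
`max_y sup_β min_x inf_α d_C(φ(x,α,y,β))`. -/
def cond3Val (G : GQGame I J d) (C : Set (EuclideanSpace ℝ (Fin d))) : ℝ :=
  ⨆ y : stdSimplex ℝ J, ⨆ β : {b : J → ℝ // ∀ j, 0 ≤ b j},
    ⨅ x : stdSimplex ℝ I, ⨅ α : {a : I → ℝ // ∀ i, 0 ≤ a i},
      Metric.infDist (G.phi x.1 α.1 y.1 β.1) C

/-- A (behavioral) strategy of player 1: a mixed action after every finite history. -/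
abbrev Strat1 (I J : Type) [Fintype I] : Type := List (I × J) → stdSimplex ℝ I

/-- A (behavioral) strategy of player 2. -/
abbrev Strat2 (I J : Type) [Fintype J] : Type := List (I × J) → stdSimplex ℝ J

/-- Expected sum of the payoffs of the next `n` stages, given the unabsorbed history `h`:
if an absorbing action pair is played, the payoff is frozen for all remaining stages. -/
def expTotal (G : GQGame I J d) (σ : Strat1 I J) (τ : Strat2 I J) :
    ℕ → List (I × J) → EuclideanSpace ℝ (Fin d)
  | 0, _ => 0
  | n + 1, h =>
      ∑ i, ∑ j,
        (((σ h : I → ℝ) i) * ((τ h : J → ℝ) j)) •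
          (if G.Istar i || G.Jstar j then ((n : ℝ) + 1) • G.g i j
           else G.g i j + G.expTotal σ τ n (h ++ [(i, j)]))

/-- Expected average payoff `E_{σ,τ}[(1/T) Σ_{t=1}^T g(i_t,j_t)]`. -/
def avg (G : GQGame I J d) (σ : Strat1 I J) (τ : Strat2 I J) (T : ℕ) :
    EuclideanSpace ℝ (Fin d) :=
  (T : ℝ)⁻¹ • G.expTotal σ τ T []

/-- `C` is weakly approachable by player 1. -/
def WeaklyApproachable1 (G : GQGame I J d) (C : Set (EuclideanSpace ℝ (Fin d))) : Prop :=
  ∀ ε > (0 : ℝ), ∃ T₀ : ℕ, ∀ T ≥ T₀, ∃ σ : Strat1 I J, ∀ τ : Strat2 I J,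
    Metric.infDist (G.avg σ τ T) C ≤ ε

/-- `C` is weakly excludable by player 2: for some `δ > 0`, player 2 can weakly approach
the set of points at distance at least `δ` from `C`. -/
def WeaklyExcludable2 (G : GQGame I J d) (C : Set (EuclideanSpace ℝ (Fin d))) : Prop :=
  ∃ δ > (0 : ℝ), ∀ ε > (0 : ℝ), ∃ T₀ : ℕ, ∀ T ≥ T₀, ∃ τ : Strat2 I J, ∀ σ : Strat1 I J,
    Metric.infDist (G.avg σ τ T) {z | δ ≤ Metric.infDist z C} ≤ ε

/-- `C` is uniformly approachable by player 1. -/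
def UniformlyApproachable1 (G : GQGame I J d) (C : Set (EuclideanSpace ℝ (Fin d))) : Prop :=
  ∀ ε > (0 : ℝ), ∃ σ : Strat1 I J, ∃ T₀ : ℕ, ∀ T ≥ T₀, ∀ τ : Strat2 I J,
    Metric.infDist (G.avg σ τ T) C ≤ ε

end GQGame


namespace GQAux

/-- Finite minimax lemma. -/
lemma minimax {L J : Type} [Fintype L] [Fintype J] [Nonempty J] (B : L → J → ℝ) (c : ℝ)
    (H : ∀ y ∈ stdSimplex ℝ J, ∃ l, ∑ j, y j * B l j ≤ c) :
    ∃ q ∈ stdSimplex ℝ L, ∀ j, ∑ l, q l * B l j ≤ c := by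
  classical
  let A : (L → ℝ) →ₗ[ℝ] (J → ℝ) :=
    { toFun := fun q j => ∑ l, q l * B l j
      map_add' := by intro a b; ext j; simp [add_mul, Finset.sum_add_distrib]
      map_smul' := by intro a b; ext j; simp [Finset.mul_sum, mul_assoc] }
  by_contra hcon
  push Not at hcon
  have hs1 : Convex ℝ (A '' stdSimplex ℝ L) := (convex_stdSimplex ℝ L).linear_image A
  have hs2 : IsCompact (A '' stdSimplex ℝ L) :=
    (isCompact_stdSimplex ℝ L).image A.continuous_of_finiteDimensional
  have ht1 : Convex ℝ {v : J → ℝ | ∀ j, v j ≤ c} := by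
    intro v hv w hw a b ha hb hab j
    have h1 := mul_le_mul_of_nonneg_left (hv j) ha
    have h2 := mul_le_mul_of_nonneg_left (hw j) hb
    have : a * c + b * c = c := by rw [← add_mul, hab, one_mul]
    simp only [Pi.add_apply, Pi.smul_apply, smul_eq_mul]
    linarith
  have ht2 : IsClosed {v : J → ℝ | ∀ j, v j ≤ c} := by
    rw [Set.ofPred_forall]
    exact isClosed_iInter fun j => isClosed_le (continuous_apply j) continuous_const
  have hd : Disjoint (A '' stdSimplex ℝ L) {v : J → ℝ | ∀ j, v j ≤ c} := by
    rw [Set.disjoint_left]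
    rintro _ ⟨q, hq, rfl⟩ hv
    obtain ⟨j, hj⟩ := hcon q hq
    exact absurd (hv j) (not_le.mpr hj)
  obtain ⟨f, u, v, h1, huv, h2⟩ := geometric_hahn_banach_compact_closed hs1 hs2 ht1 ht2 hd
  set a : J → ℝ := fun j => f (fun k => if j = k then 1 else 0) with ha
  have hf : ∀ w : J → ℝ, f w = ∑ j, w j * a j := by
    intro w
    have := LinearMap.pi_apply_eq_sum_univ (f : (J → ℝ) →ₗ[ℝ] ℝ) w
    simpa [ha] using this
  have hcv : v < ∑ j, c * a j := by
    have := h2 (fun _ => c) (fun _ => le_rfl)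
    rwa [hf] at this
  have haneg : ∀ j, a j ≤ 0 := by
    intro j
    by_contra hj
    push Not at hj
    set s := ((∑ j, c * a j) - v) / a j with hs
    have hs0 : 0 ≤ s := div_nonneg (by linarith) hj.le
    have := h2 ((fun _ => c) - s • (fun k => if j = k then 1 else 0)) (by
      intro k
      by_cases hk : j = k <;> simp [hk, hs0])
    rw [map_sub, map_smul, hf] at this
    change v < (∑ j, c * a j) - s * a j at this
    rw [hs, div_mul_cancel₀ _ hj.ne'] at this
    linarith
  have hrow : ∀ l, ∑ j, B l j * a j < u := by
    intro l
    have := h1 (A (Pi.single l 1)) ⟨_, single_mem_stdSimplex ℝ l, rfl⟩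
    rw [hf] at this
    simpa [A, Pi.single_apply] using this
  have hS : 0 ≤ ∑ j, -a j := Finset.sum_nonneg fun j _ => by linarith [haneg j]
  rcases hS.lt_or_eq with hS | hS
  · obtain ⟨l, hl⟩ := H (fun j => (∑ j, -a j)⁻¹ * -a j)
      ⟨fun j => mul_nonneg (inv_nonneg.mpr hS.le) (by linarith [haneg j]), by
        rw [← Finset.mul_sum, inv_mul_cancel₀ hS.ne']⟩
    simp only [mul_assoc] at hl
    rw [← Finset.mul_sum, inv_mul_le_iff₀ hS] at hl
    have e1 : ∑ j, -a j * B l j = -∑ j, B l j * a j := by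
      rw [← Finset.sum_neg_distrib]; exact Finset.sum_congr rfl fun j _ => by ring
    have e2 : (∑ j, -a j) * c = -∑ j, c * a j := by
      rw [← Finset.sum_neg_distrib, Finset.sum_mul]; exact Finset.sum_congr rfl fun j _ => by ring
    have := hrow l
    linarith
  · have ha0 : ∀ j, a j = 0 := by
      intro j
      have := (Finset.sum_eq_zero_iff_of_nonneg (s := Finset.univ) (f := fun j => -a j)
        (fun j _ => by linarith [haneg j])).1 hS.symm j (Finset.mem_univ j)
      linarith
    obtain ⟨j0⟩ := ‹Nonempty J›
    obtain ⟨l, -⟩ := H (Pi.single j0 1) (single_mem_stdSimplex ℝ j0)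
    have := hrow l
    simp only [ha0, mul_zero, Finset.sum_const_zero] at this hcv
    linarith

variable {I J : Type} [Fintype I] [Fintype J] {E : Type*} [NormedAddCommGroup E]
  [InnerProductSpace ℝ E]

/-- Bilinear extension. -/
noncomputable def bl (f : I → J → E) : (I → ℝ) →ₗ[ℝ] (J → ℝ) →ₗ[ℝ] E :=
  LinearMap.mk₂ ℝ (fun x y => ∑ i, ∑ j, (x i * y j) • f i j)
    (by intro a b y; simp [add_mul, add_smul, Finset.sum_add_distrib])
    (by intro a b y; simp [Finset.smul_sum, smul_smul, mul_assoc])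
    (by intro a b y; simp [mul_add, add_smul, Finset.sum_add_distrib])
    (by intro a b y; simp [Finset.smul_sum, smul_smul, mul_left_comm])

lemma bl_apply (f : I → J → E) (x : I → ℝ) (y : J → ℝ) :
    bl f x y = ∑ i, ∑ j, (x i * y j) • f i j := rfl

lemma norm_bl_le (f : I → J → E) (r : ℝ) (hf : ∀ i j, ‖f i j‖ ≤ r) (a : I → ℝ) (ha : ∀ i, 0 ≤ a i)
    (y : J → ℝ) (hy : y ∈ stdSimplex ℝ J) : ‖bl f a y‖ ≤ (∑ i, a i) * r := by
  rw [bl_apply]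
  calc _ ≤ ∑ i, ∑ j, (a i * y j) * r := by
        refine (norm_sum_le _ _).trans (Finset.sum_le_sum fun i _ => ?_)
        refine (norm_sum_le _ _).trans (Finset.sum_le_sum fun j _ => ?_)
        rw [norm_smul, Real.norm_of_nonneg (mul_nonneg (ha i) (hy.1 j))]
        exact mul_le_mul_of_nonneg_left (hf i j) (mul_nonneg (ha i) (hy.1 j))
    _ = _ := by
        simp_rw [← Finset.sum_mul, ← Finset.mul_sum, hy.2, mul_one]

/-- One-step lemma. -/
lemma one_step [Nonempty J] (f fs : I → J → E) (hf : ∀ i j, ‖f i j‖ ≤ 2)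
    (K : Set E) (K0 : (0 : E) ∈ K) (Kadd : ∀ a ∈ K, ∀ b ∈ K, a + b ∈ K)
    (Ksmul : ∀ c : ℝ, 0 ≤ c → ∀ a ∈ K, c • a ∈ K)
    (H : ∀ y ∈ stdSimplex ℝ J, ∃ x ∈ stdSimplex ℝ I, ∃ α : I → ℝ, (∀ i, 0 ≤ α i) ∧
      ∀ β : J → ℝ, (∀ j, 0 ≤ β j) → bl f x y + bl fs α y + bl fs x β ∈ K)
    (η : ℝ) (hη : 0 < η) :
    ∃ (R : ℝ) (m0 : ℕ), 0 ≤ R ∧ ∀ M : E, ∃ D : J → E,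
      (∀ j, inner ℝ M (D j) ≤ η * ‖M‖) ∧ (∀ j, ‖D j‖ ≤ R) ∧
      ∀ m : ℕ, m0 ≤ m → ∃ x ∈ stdSimplex ℝ I, ∀ y ∈ stdSimplex ℝ J, ∃ k ∈ K,
        ‖bl f x y + (m : ℝ) • bl fs x y - k - ∑ j, y j • D j‖ ≤ η := by
  classical
  choose! X hX Al hAl hK using H
  let A : (J → ℝ) → (J → ℝ) →ₗ[ℝ] E := fun l => bl f (X l) + bl fs (Al l)
  have hAc : ∀ l, Continuous (A l) := fun l => (A l).continuous_of_finiteDimensional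
  obtain ⟨t, ht, hcov⟩ := (isCompact_stdSimplex ℝ J).elim_nhds_subcover
    (fun l => {z | ‖A l (z - l)‖ < η}) (by
      intro l hl
      refine IsOpen.mem_nhds (isOpen_lt ((hAc l).comp (continuous_id.sub continuous_const)).norm
        continuous_const) ?_
      simpa using hη)
  let e : J → J → ℝ := fun j k => if j = k then 1 else 0
  have hAsum : ∀ l, ∀ y ∈ stdSimplex ℝ J, A l (y - l) = ∑ j, y j • A l (e j - l) := by
    intro l y hy
    simp_rw [map_sub, smul_sub, Finset.sum_sub_distrib, ← Finset.sum_smul, hy.2, one_smul]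
    rw [← LinearMap.pi_apply_eq_sum_univ]
  let S : ℝ := ∑ l ∈ t, ∑ i, Al l i
  have hSl : ∀ l ∈ t, ∑ i, Al l i ≤ S := fun l hl =>
    Finset.single_le_sum (f := fun l => ∑ i, Al l i)
      (fun l hl => Finset.sum_nonneg fun i _ => hAl l (ht l hl) i) hl
  have hRl : ∀ l ∈ t, ∀ j, ‖A l (e j - l)‖ ≤ ∑ l ∈ t, ∑ j, ‖A l (e j - l)‖ := fun l hl j =>
    (Finset.single_le_sum (f := fun j => ‖A l (e j - l)‖) (fun _ _ => norm_nonneg _)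
      (Finset.mem_univ j)).trans
    (Finset.single_le_sum (f := fun l => ∑ j, ‖A l (e j - l)‖)
      (fun l hl => Finset.sum_nonneg fun _ _ => norm_nonneg _) hl)
  obtain ⟨m1, hm1⟩ := exists_nat_ge (max 1 (max S (4 * S / η)))
  refine ⟨∑ l ∈ t, ∑ j, ‖A l (e j - l)‖, m1, by positivity, fun M => ?_⟩
  obtain ⟨q, hq, hqj⟩ := minimax (L := t) (fun l j => inner ℝ M (A l (e j - l))) (η * ‖M‖) (by
    intro y hy
    have := hcov hy
    simp only [Set.mem_iUnion, Set.mem_ofPred_eq] at this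
    obtain ⟨l, hl, hly⟩ := this
    refine ⟨⟨l, hl⟩, ?_⟩
    have e1 : ∑ j, y j * inner ℝ M (A l (e j - l)) = inner ℝ M (A l (y - l)) := by
      rw [hAsum l y hy, inner_sum]
      exact Finset.sum_congr rfl fun j _ => by rw [inner_smul_right]
    change ∑ j, y j * inner ℝ M (A l (e j - l)) ≤ _
    rw [e1, mul_comm]
    exact (real_inner_le_norm _ _).trans (mul_le_mul_of_nonneg_left hly.le (norm_nonneg _)))
  refine ⟨fun j => ∑ l : t, q l • A l (e j - l), fun j => ?_, fun j => ?_, fun m hm => ?_⟩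
  · rw [inner_sum]
    simp_rw [inner_smul_right]
    exact hqj j
  · refine (norm_sum_le _ _).trans ?_
    calc _ ≤ ∑ l : t, q l * (∑ l ∈ t, ∑ j, ‖A l (e j - l)‖) := by
          refine Finset.sum_le_sum fun l _ => ?_
          rw [norm_smul, Real.norm_of_nonneg (hq.1 l)]
          exact mul_le_mul_of_nonneg_left (hRl l l.2 j) (hq.1 l)
      _ = _ := by rw [← Finset.sum_mul, hq.2, one_mul]
  · have hmm : max 1 (max S (4 * S / η)) ≤ (m : ℝ) := hm1.trans (by exact_mod_cast hm)
    have hmge1 : (1 : ℝ) ≤ m := (le_max_left _ _).trans hmm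
    have hmS : S ≤ m := ((le_max_left _ _).trans (le_max_right _ _)).trans hmm
    have hmη : 4 * S / η ≤ m := ((le_max_right _ _).trans (le_max_right _ _)).trans hmm
    have hm0 : (0 : ℝ) < m := by linarith
    let s : (J → ℝ) → ℝ := fun l => ∑ i, Al l i
    let P : (J → ℝ) → I → ℝ := fun l => X l + (m : ℝ)⁻¹ • (Al l - s l • X l)
    have hs0 : ∀ l ∈ t, 0 ≤ s l := fun l hl => Finset.sum_nonneg fun i _ => hAl l (ht l hl) i
    have hP : ∀ l ∈ t, P l ∈ stdSimplex ℝ I := by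
      intro l hl
      have hx := hX l (ht l hl)
      constructor
      · intro i
        have h1 : P l i = (m : ℝ)⁻¹ * (((m : ℝ) - s l) * X l i + Al l i) := by
          simp only [P, Pi.add_apply, Pi.smul_apply, Pi.sub_apply, smul_eq_mul]
          field_simp
          ring
        rw [h1]
        have h2 : 0 ≤ (m : ℝ) - s l := by have := hSl l hl; simp only [s]; linarith
        have := hx.1 i
        have := hAl l (ht l hl) i
        positivity
      · simp only [P, Pi.add_apply, Pi.smul_apply, Pi.sub_apply, smul_eq_mul,
          Finset.sum_add_distrib, ← Finset.mul_sum, Finset.sum_sub_distrib, hx.2]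
        simp [s]
    refine ⟨∑ l : t, q l • P l, ?_, fun y hy => ?_⟩
    · exact (convex_stdSimplex ℝ I).sum_mem (fun l _ => hq.1 l) hq.2 (fun l _ => hP l l.2)
    let k : (J → ℝ) → E := fun l =>
      bl f (X l) l + bl fs (Al l) l + bl fs (X l) (((m : ℝ) - s l) • y)
    have hk : ∀ l ∈ t, k l ∈ K := by
      intro l hl
      refine hK l (ht l hl) _ fun j => ?_
      have h2 : 0 ≤ (m : ℝ) - s l := by have := hSl l hl; simp only [s]; linarith
      exact mul_nonneg h2 (hy.1 j)
    refine ⟨∑ l : t, q l • k l, ?_, ?_⟩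
    · refine Finset.sum_induction _ (· ∈ K) (fun a b ha hb => Kadd a ha b hb) K0 ?_
      intro l _
      exact Ksmul _ (hq.1 l) _ (hk l l.2)
    have key : bl f (∑ l : t, q l • P l) y + (m : ℝ) • bl fs (∑ l : t, q l • P l) y
        - ∑ l : t, q l • k l - ∑ j, y j • ∑ l : t, q l • A l (e j - l)
        = ∑ l : t, q l • ((m : ℝ)⁻¹ • (bl f (Al l) y - s l • bl f (X l) y)) := by
      have e1 : ∑ j, y j • ∑ l : t, q l • A l (e j - l) = ∑ l : t, q l • A l (y - l) := by
        simp_rw [hAsum _ y hy, Finset.smul_sum, smul_smul]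
        rw [Finset.sum_comm]
        simp_rw [mul_comm]
      rw [e1]
      simp only [map_sum, map_smul, LinearMap.sum_apply, LinearMap.smul_apply]
      rw [Finset.smul_sum, ← Finset.sum_add_distrib, ← Finset.sum_sub_distrib,
        ← Finset.sum_sub_distrib]
      refine Finset.sum_congr rfl fun l _ => ?_
      rw [smul_comm (m : ℝ) (q l), ← smul_add, ← smul_sub, ← smul_sub]
      congr 1
      have e2 : (m : ℝ) • bl fs (P l) y
          = (m : ℝ) • bl fs (X l) y + bl fs (Al l) y - s l • bl fs (X l) y := by
        simp only [P, map_add, map_smul, map_sub, LinearMap.add_apply, LinearMap.smul_apply,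
          LinearMap.sub_apply, smul_add, smul_smul]
        rw [mul_inv_cancel₀ hm0.ne', one_smul]
        abel
      rw [e2]
      simp only [P, k, A, map_add, map_smul, map_sub, LinearMap.add_apply, LinearMap.smul_apply,
          LinearMap.sub_apply, sub_smul]
      abel
    rw [key]
    refine (norm_sum_le _ _).trans ?_
    calc _ ≤ ∑ l : t, q l * η := by
          refine Finset.sum_le_sum fun l _ => ?_
          rw [norm_smul, Real.norm_of_nonneg (hq.1 l)]
          refine mul_le_mul_of_nonneg_left ?_ (hq.1 l)
          rw [norm_smul, norm_inv, Real.norm_of_nonneg hm0.le, inv_mul_le_iff₀ hm0]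
          have b1 := norm_bl_le f 2 hf (Al l) (hAl l (ht l l.2)) y hy
          have b2 := norm_bl_le f 2 hf (X l) (hX l (ht l l.2)).1 y hy
          rw [(hX l (ht l l.2)).2] at b2
          have b3 := norm_sub_le (bl f (Al l) y) (s l • bl f (X l) y)
          rw [norm_smul, Real.norm_of_nonneg (hs0 l l.2)] at b3
          have b4 := mul_le_mul_of_nonneg_left b2 (hs0 l l.2)
          have b5 := hSl l l.2
          rw [div_le_iff₀ hη] at hmη
          change ‖bl f (Al l) y‖ ≤ s l * 2 at b1
          change s l ≤ S at b5
          linarith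
      _ = η := by rw [← Finset.sum_mul, hq.2, one_mul]

/-- Sum of a family with product weights depending only on the second index. -/
lemma sum_prod_weights (x : I → ℝ) (hx : x ∈ stdSimplex ℝ I) (y : J → ℝ) (v : J → E) :
    ∑ i, ∑ j, (x i * y j) • v j = ∑ j, y j • v j := by
  simp_rw [← smul_smul, ← Finset.smul_sum, ← Finset.sum_smul, hx.2, one_smul]

lemma norm_prod_weights_le (x : I → ℝ) (hx : x ∈ stdSimplex ℝ I) (y : J → ℝ)
    (hy : y ∈ stdSimplex ℝ J) (w : I → J → E) (r : ℝ) (hw : ∀ i j, ‖w i j‖ ≤ r) :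
    ‖∑ i, ∑ j, (x i * y j) • w i j‖ ≤ r := by
  have := norm_bl_le w r hw x hx.1 y hy
  rwa [hx.2, one_mul, bl_apply] at this

/-- Multi-stage lemma. -/
lemma multi [Nonempty I] [Nonempty J] (ab : I → J → Bool) (f : I → J → E)
    (hf : ∀ i j, ‖f i j‖ ≤ 2)
    (K : Set E) (K0 : (0 : E) ∈ K) (Kadd : ∀ a ∈ K, ∀ b ∈ K, a + b ∈ K)
    (Ksmul : ∀ c : ℝ, 0 ≤ c → ∀ a ∈ K, c • a ∈ K)
    (H : ∀ y ∈ stdSimplex ℝ J, ∃ x ∈ stdSimplex ℝ I, ∃ α : I → ℝ, (∀ i, 0 ≤ α i) ∧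
      ∀ β : J → ℝ, (∀ j, 0 ≤ β j) → bl f x y
        + bl (fun i j => if ab i j then f i j else 0) α y
        + bl (fun i j => if ab i j then f i j else 0) x β ∈ K)
    (ε : ℝ) (hε : 0 < ε) :
    ∃ T₀ : ℕ, ∀ T ≥ T₀, ∃ σ : List (I × J) → stdSimplex ℝ I,
      ∀ (τ : List (I × J) → stdSimplex ℝ J) (V : ℕ → List (I × J) → E),
      (∀ h, V 0 h = 0) →
      (∀ n h, V (n + 1) h = ∑ i, ∑ j, (((σ h : I → ℝ) i) * ((τ h : J → ℝ) j)) •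
          (if ab i j then ((n : ℝ) + 1) • f i j else f i j + V n (h ++ [(i, j)]))) →
      ∃ k ∈ K, ‖V T [] - k‖ ≤ ε * T := by
  classical
  have hη : 0 < ε / 8 := by positivity
  set η := ε / 8 with hηdef
  obtain ⟨R, m0, hR, hstep⟩ := one_step f _ hf K K0 Kadd Ksmul H η hη
  choose D hD1 hD2 hD3 using hstep
  choose X hX hXK using hD3
  let Mh : List (I × J) → E := fun h => h.foldl (fun M p => M + D M p.2) 0
  have hMh : ∀ h p, Mh (h ++ [p]) = Mh h + D (Mh h) p.2 := by
    intro h p; simp [Mh, List.foldl_append]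
  set c0 : ℝ := R ^ 2 / (2 * η) + R with hc0
  have hc0n : 0 ≤ c0 := by positivity
  have hMb : ∀ h, ‖Mh h‖ ≤ c0 + 2 * η * h.length := by
    intro h
    induction h using List.reverseRecOn with
    | nil => simpa [Mh] using hc0n
    | append_singleton h p ih =>
      rw [hMh]
      set M := Mh h
      have hlen : ((h ++ [p]).length : ℝ) = h.length + 1 := by simp
      rw [hlen]
      by_cases hM : ‖M‖ ≤ R ^ 2 / (2 * η)
      · have h1 := norm_add_le M (D M p.2)
        have h2 := hD2 M p.2
        have : 0 ≤ 2 * η * ((h.length : ℝ) + 1) := by positivity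
        linarith
      · push Not at hM
        rw [div_lt_iff₀ (by positivity)] at hM
        have h1 := hD1 M p.2
        have h2 : ‖D M p.2‖ ^ 2 ≤ R ^ 2 := pow_le_pow_left₀ (norm_nonneg _) (hD2 M p.2) 2
        have h3 := norm_add_sq_real M (D M p.2)
        have h4 : ‖M + D M p.2‖ ≤ ‖M‖ + 2 * η := by
          refine abs_le_of_sq_le_sq' ?_ (by positivity) |>.2
          nlinarith [norm_nonneg M, sq_nonneg η]
        linarith
  obtain ⟨T0, hT0⟩ := exists_nat_ge ((c0 + 2 * m0) / (ε / 2))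
  refine ⟨T0, fun T hT => ?_⟩
  obtain ⟨x0⟩ : Nonempty (stdSimplex ℝ I) := inferInstance
  let σ : List (I × J) → stdSimplex ℝ I := fun h =>
    if hm : m0 ≤ T - h.length - 1 then ⟨X (Mh h) _ hm, hX _ _ _⟩ else x0
  refine ⟨σ, fun τ V V0 VS => ?_⟩
  have hVb : ∀ n h, ‖V n h‖ ≤ 2 * n := by
    intro n
    induction n with
    | zero => intro h; simp [V0]
    | succ n ih =>
      intro h
      rw [VS]
      refine norm_prod_weights_le _ (σ h).2 _ (τ h).2 _ _ fun i j => ?_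
      push_cast
      split_ifs
      · rw [norm_smul, Real.norm_of_nonneg (by positivity)]
        nlinarith [hf i j]
      · have := norm_add_le (f i j) (V n (h ++ [(i, j)]))
        linarith [hf i j, ih (h ++ [(i, j)])]
  set B : ℝ := c0 + 2 * η * T with hB
  have hMB : ∀ h : List (I × J), h.length ≤ T → ‖Mh h‖ ≤ B := by
    intro h hh
    have : (h.length : ℝ) ≤ T := by exact_mod_cast hh
    have := hMb h
    nlinarith
  have claim : ∀ n h, h.length + n = T → ∃ k ∈ K, ‖V n h + Mh h - k‖ ≤ B + 2 * m0 + η * n := by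
    intro n
    induction n with
    | zero =>
      intro h hh
      refine ⟨0, K0, ?_⟩
      have := hMB h (by omega)
      simp only [V0, zero_add, sub_zero]
      push_cast
      have : (0 : ℝ) ≤ m0 := by positivity
      linarith
    | succ m ih =>
      intro h hh
      by_cases hm : m0 ≤ m
      swap
      · refine ⟨0, K0, ?_⟩
        have h1 := hMB h (by omega)
        have h2 := hVb (m + 1) h
        have h3 := norm_add_le (V (m + 1) h) (Mh h)
        have h4 : ((m + 1 : ℕ) : ℝ) ≤ m0 := by exact_mod_cast (by omega : m + 1 ≤ m0)
        have h5 : 0 ≤ η * ((m + 1 : ℕ) : ℝ) := by positivity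
        rw [sub_zero]
        linarith
      have hTm : T - h.length - 1 = m := by omega
      subst hTm
      have hσ : (σ h : I → ℝ) = X (Mh h) _ hm := by
        simp [σ, hm]; rfl
      set m := T - h.length - 1
      set x : I → ℝ := (σ h : I → ℝ) with hxdef
      set y : J → ℝ := (τ h : J → ℝ) with hydef
      have hx : x ∈ stdSimplex ℝ I := (σ h).2
      have hy : y ∈ stdSimplex ℝ J := (τ h).2
      obtain ⟨k0, hk0, hk0e⟩ := hXK (Mh h) m hm y hy
      rw [← hσ] at hk0e
      let b : I → J → E := fun i j =>
        (if ab i j then 0 else V m (h ++ [(i, j)])) + Mh (h ++ [(i, j)])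
      have hb : ∀ i j, ∃ k ∈ K, ‖b i j - k‖ ≤ B + 2 * m0 + η * m := by
        intro i j
        by_cases hab : ab i j
        · refine ⟨0, K0, ?_⟩
          simp only [b, hab, if_true, zero_add, sub_zero]
          have := hMB (h ++ [(i, j)]) (by simp; omega)
          have : (0 : ℝ) ≤ 2 * m0 + η * m := by positivity
          linarith
        · obtain ⟨k, hk, hke⟩ := ih (h ++ [(i, j)]) (by simp; omega)
          refine ⟨k, hk, ?_⟩
          simpa [b, hab] using hke
      choose kk hkk hkke using hb
      refine ⟨k0 + ∑ i, ∑ j, (x i * y j) • kk i j, Kadd _ hk0 _ ?_, ?_⟩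
      · refine Finset.sum_induction _ (· ∈ K) (fun a b ha hb => Kadd a ha b hb) K0 fun i _ => ?_
        refine Finset.sum_induction _ (· ∈ K) (fun a b ha hb => Kadd a ha b hb) K0 fun j _ => ?_
        exact Ksmul _ (mul_nonneg (hx.1 i) (hy.1 j)) _ (hkk i j)
      have key : V (m + 1) h + Mh h - (k0 + ∑ i, ∑ j, (x i * y j) • kk i j)
          = (bl f x y + (m : ℝ) • bl (fun i j => if ab i j then f i j else 0) x y - k0
              - ∑ j, y j • D (Mh h) j)
            + ∑ i, ∑ j, (x i * y j) • (b i j - kk i j) := by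
        have e1 : ∑ i, ∑ j, (x i * y j) • (Mh h + D (Mh h) j)
            = Mh h + ∑ j, y j • D (Mh h) j := by
          rw [sum_prod_weights x hx y (fun j => Mh h + D (Mh h) j)]
          simp_rw [smul_add, Finset.sum_add_distrib, ← Finset.sum_smul, hy.2, one_smul]
        have e2 : V (m + 1) h = bl f x y
            + (m : ℝ) • bl (fun i j => if ab i j then f i j else 0) x y
            + ∑ i, ∑ j, (x i * y j) • (if ab i j then 0 else V m (h ++ [(i, j)])) := by
          rw [VS, bl_apply, bl_apply]
          simp_rw [Finset.smul_sum, ← Finset.sum_add_distrib]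
          refine Finset.sum_congr rfl fun i _ => Finset.sum_congr rfl fun j _ => ?_
          rw [smul_comm (m : ℝ), ← smul_add, ← smul_add]
          congr 1
          split_ifs
          · rw [add_smul, one_smul]; abel
          · simp
        have e3 : ∑ i, ∑ j, (x i * y j) • (b i j - kk i j)
            = ∑ i, ∑ j, (x i * y j) • (if ab i j then 0 else V m (h ++ [(i, j)]))
              + (Mh h + ∑ j, y j • D (Mh h) j) - ∑ i, ∑ j, (x i * y j) • kk i j := by
          rw [← e1]
          simp only [b, hMh, smul_sub, smul_add, Finset.sum_add_distrib, Finset.sum_sub_distrib]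
        rw [e2, e3]
        abel
      rw [key]
      refine (norm_add_le _ _).trans ?_
      have h1 := norm_prod_weights_le x hx y hy (fun i j => b i j - kk i j) _ hkke
      push_cast
      linarith
  obtain ⟨k, hk, hke⟩ := claim T [] (by simp)
  refine ⟨k, hk, ?_⟩
  have hM0 : Mh [] = 0 := rfl
  rw [hM0, add_zero] at hke
  have hTT : (c0 + 2 * m0) / (ε / 2) ≤ (T : ℝ) := hT0.trans (by exact_mod_cast hT)
  rw [div_le_iff₀ (by positivity)] at hTT
  have hTn : (0 : ℝ) ≤ T := by positivity
  have : 3 * (η * T) ≤ ε * T / 2 := by rw [hηdef]; nlinarith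
  linarith

end GQAux

namespace GQAux

open GQGame

variable {I J : Type} {d : ℕ} [Fintype I] [Fintype J]

abbrev Lift (d : ℕ) : Type := WithLp 2 (EuclideanSpace ℝ (Fin d) × ℝ)

def lf (G : GQGame I J d) : I → J → Lift d := fun i j => WithLp.toLp 2 (G.g i j, 1)

def lab (G : GQGame I J d) : I → J → Bool := fun i j => G.Istar i || G.Jstar j

lemma fst_sum' {ι : Type} (s : Finset ι) (v : ι → Lift d) :
    (∑ i ∈ s, v i).fst = ∑ i ∈ s, (v i).fst :=
  map_sum (WithLp.fstₗ 2 ℝ (EuclideanSpace ℝ (Fin d)) ℝ) v s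

lemma snd_sum' {ι : Type} (s : Finset ι) (v : ι → Lift d) :
    (∑ i ∈ s, v i).snd = ∑ i ∈ s, (v i).snd :=
  map_sum (WithLp.sndₗ 2 ℝ (EuclideanSpace ℝ (Fin d)) ℝ) v s

lemma ext' {u v : Lift d} (h1 : u.fst = v.fst) (h2 : u.snd = v.snd) : u = v := by
  apply WithLp.ofLp_injective 2
  exact Prod.ext h1 h2

lemma norm_gstar_le (G : GQGame I J d) (hg : ∀ i j, ‖G.g i j‖ ≤ 1) (a : I → ℝ) (b : J → ℝ)
    (ha : ∀ i, 0 ≤ a i) (hb : ∀ j, 0 ≤ b j) : ‖G.gstar a b‖ ≤ G.pstar a b := by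
  unfold gstar pstar
  refine (norm_sum_le _ _).trans (Finset.sum_le_sum fun i _ => ?_)
  refine (norm_sum_le _ _).trans (Finset.sum_le_sum fun j _ => ?_)
  split_ifs
  · rw [norm_smul, Real.norm_of_nonneg (mul_nonneg (ha i) (hb j))]
    have := mul_nonneg (ha i) (hb j)
    nlinarith [hg i j]
  · simp

lemma pstar_nonneg (G : GQGame I J d) (a : I → ℝ) (b : J → ℝ)
    (ha : ∀ i, 0 ≤ a i) (hb : ∀ j, 0 ≤ b j) : 0 ≤ G.pstar a b := by
  unfold pstar
  refine Finset.sum_nonneg fun i _ => Finset.sum_nonneg fun j _ => ?_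
  split_ifs
  · exact mul_nonneg (ha i) (hb j)
  · exact le_rfl

lemma norm_phi_le (G : GQGame I J d) (hg : ∀ i j, ‖G.g i j‖ ≤ 1) (x α : I → ℝ) (y β : J → ℝ)
    (hx : x ∈ stdSimplex ℝ I) (hα : ∀ i, 0 ≤ α i) (hy : y ∈ stdSimplex ℝ J)
    (hβ : ∀ j, 0 ≤ β j) : ‖G.phi x α y β‖ ≤ 1 := by
  have p1 := pstar_nonneg G α y hα hy.1
  have p2 := pstar_nonneg G x β hx.1 hβ
  have n1 := norm_gstar_le G hg α y hα hy.1
  have n2 := norm_gstar_le G hg x β hx.1 hβ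
  have n3 : ‖G.mix x y‖ ≤ 1 := norm_prod_weights_le x hx y hy G.g 1 hg
  have n4 := norm_add₃_le (a := G.mix x y) (b := G.gstar α y) (c := G.gstar x β)
  have pp : 0 < 1 + G.pstar α y + G.pstar x β := by linarith
  unfold phi
  rw [norm_smul, norm_inv, Real.norm_of_nonneg pp.le, inv_mul_le_iff₀ pp]
  linarith

lemma lift_eq (G : GQGame I J d) (x α : I → ℝ) (y β : J → ℝ)
    (hx : x ∈ stdSimplex ℝ I) (hy : y ∈ stdSimplex ℝ J) :
    bl (lf G) x y + bl (fun i j => if lab G i j then lf G i j else 0) α y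
      + bl (fun i j => if lab G i j then lf G i j else 0) x β
    = WithLp.toLp 2 (G.mix x y + G.gstar α y + G.gstar x β,
        1 + G.pstar α y + G.pstar x β) := by
  have hs : ∀ (a : I → ℝ) (b : J → ℝ), bl (fun i j => if lab G i j then lf G i j else 0) a b
      = WithLp.toLp 2 (G.gstar a b, G.pstar a b) := by
    intro a b
    rw [bl_apply]
    refine ext' ?_ ?_
    · simp only [fst_sum', WithLp.smul_fst, gstar, WithLp.toLp_fst]
      refine Finset.sum_congr rfl fun i _ => Finset.sum_congr rfl fun j _ => ?_
      unfold lab lf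
      split_ifs <;> simp
    · simp only [snd_sum', WithLp.smul_snd, pstar, WithLp.toLp_snd]
      refine Finset.sum_congr rfl fun i _ => Finset.sum_congr rfl fun j _ => ?_
      unfold lab lf
      split_ifs <;> simp
  have hm : bl (lf G) x y = WithLp.toLp 2 (G.mix x y, 1) := by
    rw [bl_apply]
    refine ext' ?_ ?_
    · simp [fst_sum', mix, lf]
    · simp only [snd_sum', WithLp.smul_snd, lf, WithLp.toLp_snd, smul_eq_mul, mul_one,
        ← Finset.mul_sum, hy.2, hx.2]
  rw [hs, hs, hm]
  rfl

lemma norm_expTotal_le (G : GQGame I J d) (hg : ∀ i j, ‖G.g i j‖ ≤ 1) (σ : Strat1 I J)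
    (τ : Strat2 I J) : ∀ n h, ‖G.expTotal σ τ n h‖ ≤ n := by
  intro n
  induction n with
  | zero => intro h; simp [expTotal]
  | succ n ih =>
    intro h
    rw [expTotal]
    refine norm_prod_weights_le _ (σ h).2 _ (τ h).2 _ _ fun i j => ?_
    push_cast
    split_ifs
    · rw [norm_smul, Real.norm_of_nonneg (by positivity)]
      nlinarith [hg i j]
    · have := norm_add_le (G.g i j) (G.expTotal σ τ n (h ++ [(i, j)]))
      linarith [hg i j, ih (h ++ [(i, j)])]

lemma cond_extract [Nonempty I] [Nonempty J] (G : GQGame I J d) (hg : ∀ i j, ‖G.g i j‖ ≤ 1)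
    (C : Set (EuclideanSpace ℝ (Fin d))) (hne : C.Nonempty) (h1 : cond1Val G C = 0)
    (δ : ℝ) (hδ : 0 < δ) (y : J → ℝ) (hy : y ∈ stdSimplex ℝ J) :
    ∃ x ∈ stdSimplex ℝ I, ∃ α : I → ℝ, (∀ i, 0 ≤ α i) ∧ ∀ β : J → ℝ, (∀ j, 0 ≤ β j) →
      Metric.infDist (G.phi x α y β) C ≤ δ := by
  obtain ⟨c, hc⟩ := hne
  have hbd : ∀ (x : stdSimplex ℝ I) (α : {a : I → ℝ // ∀ i, 0 ≤ a i}) (y : stdSimplex ℝ J)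
      (β : {b : J → ℝ // ∀ j, 0 ≤ b j}),
      Metric.infDist (G.phi x.1 α.1 y.1 β.1) C ≤ 1 + ‖c‖ := by
    intro x α y β
    refine (Metric.infDist_le_dist_of_mem hc).trans ?_
    rw [dist_eq_norm]
    refine (norm_sub_le _ _).trans ?_
    have := norm_phi_le G hg x.1 α.1 y.1 β.1 x.2 α.2 y.2 β.2
    linarith
  have : Nonempty {a : I → ℝ // ∀ i, 0 ≤ a i} := ⟨⟨0, fun _ => le_rfl⟩⟩
  have : Nonempty {b : J → ℝ // ∀ j, 0 ≤ b j} := ⟨⟨0, fun _ => le_rfl⟩⟩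
  have hlt : (⨅ x : stdSimplex ℝ I, ⨅ α : {a : I → ℝ // ∀ i, 0 ≤ a i},
      ⨆ β : {b : J → ℝ // ∀ j, 0 ≤ b j}, Metric.infDist (G.phi x.1 α.1 y β.1) C) < δ := by
    refine lt_of_le_of_lt ?_ hδ
    refine le_trans ?_ h1.le
    unfold cond1Val
    refine le_ciSup (f := fun y : stdSimplex ℝ J => ⨅ x : stdSimplex ℝ I,
      ⨅ α : {a : I → ℝ // ∀ i, 0 ≤ a i}, ⨆ β : {b : J → ℝ // ∀ j, 0 ≤ b j},
      Metric.infDist (G.phi x.1 α.1 y.1 β.1) C) ?_ (⟨y, hy⟩ : stdSimplex ℝ J)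
    refine ⟨1 + ‖c‖, ?_⟩
    rintro _ ⟨y, rfl⟩
    have x0 : stdSimplex ℝ I := Classical.arbitrary _
    have α0 : {a : I → ℝ // ∀ i, 0 ≤ a i} := Classical.arbitrary _
    have nn : ∀ (x : stdSimplex ℝ I) (α : {a : I → ℝ // ∀ i, 0 ≤ a i}),
        0 ≤ ⨆ β : {b : J → ℝ // ∀ j, 0 ≤ b j}, Metric.infDist (G.phi x.1 α.1 y.1 β.1) C :=
      fun x α => Real.iSup_nonneg fun β => Metric.infDist_nonneg
    refine (ciInf_le ⟨0, ?_⟩ x0).trans ((ciInf_le ⟨0, ?_⟩ α0).trans (ciSup_le fun β => hbd _ _ _ _))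
    · rintro _ ⟨x, rfl⟩
      exact Real.iInf_nonneg fun α => nn x α
    · rintro _ ⟨α, rfl⟩
      exact nn x0 α
  obtain ⟨x, hx⟩ := exists_lt_of_ciInf_lt hlt
  obtain ⟨α, hα⟩ := exists_lt_of_ciInf_lt hx
  refine ⟨x.1, x.2, α.1, α.2, fun β hβ => ?_⟩
  refine le_trans ?_ hα.le
  refine le_ciSup (f := fun β : {b : J → ℝ // ∀ j, 0 ≤ b j} =>
    Metric.infDist (G.phi x.1 α.1 y β.1) C) ⟨1 + ‖c‖, ?_⟩ ⟨β, hβ⟩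
  rintro _ ⟨β, rfl⟩
  exact hbd x α ⟨y, hy⟩ β

open scoped Pointwise in
lemma main [Nonempty I] [Nonempty J]
    (G : GQGame I J d) (hg : ∀ i j, ‖G.g i j‖ ≤ 1)
    (C : Set (EuclideanSpace ℝ (Fin d))) (hCconv : Convex ℝ C)
    (h1 : cond1Val G C = 0) :
    G.WeaklyApproachable1 C := by
  intro ε hε
  rcases C.eq_empty_or_nonempty with rfl | hne
  · obtain ⟨x0⟩ : Nonempty (stdSimplex ℝ I) := inferInstance
    exact ⟨0, fun T _ => ⟨fun _ => x0, fun τ => by simp [hε.le]⟩⟩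
  have hδ : 0 < ε / 2 := by positivity
  let Cd : Set (EuclideanSpace ℝ (Fin d)) := Metric.cthickening (ε / 2) C
  have hCd : ∀ z, z ∈ Cd ↔ Metric.infDist z C ≤ ε / 2 := by
    intro z
    rw [Metric.mem_cthickening_iff, Metric.infDist,
      ENNReal.le_ofReal_iff_toReal_le (Metric.infEDist_ne_top hne) hδ.le]
  have hCdc : Convex ℝ Cd := hCconv.cthickening _
  have hCdne : Cd.Nonempty := hne.mono (Metric.self_subset_cthickening C)
  let K : Set (Lift d) := {v | 0 ≤ v.snd ∧ v.fst ∈ v.snd • Cd}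
  have K0 : (0 : Lift d) ∈ K := by
    refine ⟨le_rfl, ?_⟩
    rw [WithLp.zero_snd, WithLp.zero_fst, Set.zero_smul_set hCdne]
    rfl
  have Kadd : ∀ a ∈ K, ∀ b ∈ K, a + b ∈ K := by
    rintro a ⟨ha1, ha2⟩ b ⟨hb1, hb2⟩
    refine ⟨add_nonneg ha1 hb1, ?_⟩
    rw [WithLp.add_snd, WithLp.add_fst, hCdc.add_smul ha1 hb1]
    exact Set.add_mem_add ha2 hb2
  have Ksmul : ∀ c : ℝ, 0 ≤ c → ∀ a ∈ K, c • a ∈ K := by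
    rintro c hc a ⟨ha1, ha2⟩
    refine ⟨mul_nonneg hc ha1, ?_⟩
    rw [WithLp.smul_snd, WithLp.smul_fst, smul_eq_mul, mul_smul]
    exact Set.smul_mem_smul_set ha2
  have hf : ∀ i j, ‖lf G i j‖ ≤ 2 := by
    intro i j
    have e := WithLp.prod_norm_sq_eq_of_L2 (lf G i j)
    have e1 : (lf G i j).fst = G.g i j := rfl
    have e2 : (lf G i j).snd = 1 := rfl
    rw [e1, e2, norm_one] at e
    have := pow_le_pow_left₀ (norm_nonneg _) (hg i j) 2
    nlinarith [norm_nonneg (lf G i j)]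
  have H : ∀ y ∈ stdSimplex ℝ J, ∃ x ∈ stdSimplex ℝ I, ∃ α : I → ℝ, (∀ i, 0 ≤ α i) ∧
      ∀ β : J → ℝ, (∀ j, 0 ≤ β j) → bl (lf G) x y
        + bl (fun i j => if lab G i j then lf G i j else 0) α y
        + bl (fun i j => if lab G i j then lf G i j else 0) x β ∈ K := by
    intro y hy
    obtain ⟨x, hx, α, hα, hb⟩ := cond_extract G hg C hne h1 (ε / 2) hδ y hy
    refine ⟨x, hx, α, hα, fun β hβ => ?_⟩
    rw [lift_eq G x α y β hx hy]
    have p1 := pstar_nonneg G α y hα hy.1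
    have p2 := pstar_nonneg G x β hx.1 hβ
    have pp : 0 < 1 + G.pstar α y + G.pstar x β := by linarith
    refine ⟨pp.le, G.phi x α y β, (hCd _).2 (hb β hβ), ?_⟩
    simp only [phi, WithLp.toLp_fst, WithLp.toLp_snd, smul_smul]
    rw [mul_inv_cancel₀ pp.ne', one_smul]
  set e : ℝ := min (1 / 2) (ε / 8) with he
  have he0 : 0 < e := lt_min (by norm_num) (by positivity)
  have he1 : e ≤ 1 / 2 := min_le_left _ _
  have he2 : e ≤ ε / 8 := min_le_right _ _
  obtain ⟨T0, hT0⟩ := multi (lab G) (lf G) hf K K0 Kadd Ksmul H e he0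
  refine ⟨max T0 1, fun T hT => ?_⟩
  obtain ⟨σ, hσ⟩ := hT0 T ((le_max_left _ _).trans hT)
  have hT1 : 1 ≤ T := (le_max_right _ _).trans hT
  have hTpos : (0 : ℝ) < T := by exact_mod_cast hT1
  refine ⟨σ, fun τ => ?_⟩
  obtain ⟨k, ⟨hk1, c, hc, hkc⟩, hk⟩ := hσ τ
    (fun n h => WithLp.toLp 2 (G.expTotal σ τ n h, (n : ℝ))) (by
      intro h; refine ext' ?_ ?_ <;> simp [expTotal]) (by
      intro n h
      refine ext' ?_ ?_
      · simp only [fst_sum', WithLp.smul_fst, WithLp.toLp_fst, expTotal]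
        refine Finset.sum_congr rfl fun i _ => Finset.sum_congr rfl fun j _ => ?_
        unfold lab lf
        split_ifs <;> simp
      · simp only [snd_sum', WithLp.smul_snd, WithLp.toLp_snd]
        have : ∀ i j, (if lab G i j then ((n : ℝ) + 1) • lf G i j
            else lf G i j + WithLp.toLp 2 (G.expTotal σ τ n (h ++ [(i, j)]), (n : ℝ))).snd
            = (n : ℝ) + 1 := by
          intro i j
          unfold lab lf
          split_ifs <;> simp [add_comm]
        simp_rw [this]
        have hs : ∑ i, (σ h : I → ℝ) i = 1 := (σ h).2.2
        have ht : ∑ j, (τ h : J → ℝ) j = 1 := (τ h).2.2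
        simp_rw [smul_eq_mul, ← Finset.sum_mul, ← Finset.mul_sum, ht, mul_one, hs]
        simp)
  simp only at hkc
  have hn := WithLp.prod_norm_sq_eq_of_L2
    ((WithLp.toLp 2 (G.expTotal σ τ T [], (T : ℝ)) : Lift d) - k)
  rw [WithLp.sub_fst, WithLp.sub_snd, WithLp.toLp_fst, WithLp.toLp_snd, ← hkc] at hn
  simp only at hn
  set v := G.expTotal σ τ T []
  set w := k.snd
  have hv : ‖v‖ ≤ T := norm_expTotal_le G hg σ τ T []
  have b1 : ‖v - w • c‖ ≤ e * T := by
    refine le_trans ?_ hk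
    refine abs_le_of_sq_le_sq' ?_ (norm_nonneg _) |>.2
    rw [hn]; nlinarith [sq_nonneg ‖(T : ℝ) - w‖]
  have b2 : |(T : ℝ) - w| ≤ e * T := by
    refine le_trans ?_ hk
    rw [← Real.norm_eq_abs]
    refine abs_le_of_sq_le_sq' ?_ (norm_nonneg _) |>.2
    rw [hn]; nlinarith [sq_nonneg ‖v - w • c‖]
  have b3 : (T : ℝ) / 2 ≤ w := by
    have := (abs_le.1 b2).2
    nlinarith
  have b4 : ‖c‖ ≤ 3 := by
    have h2 : ‖w • c‖ ≤ ‖v‖ + ‖v - w • c‖ := by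
      have := norm_sub_le v (v - w • c)
      simpa using this
    rw [norm_smul, Real.norm_of_nonneg hk1] at h2
    have h3 : (T : ℝ) / 2 * ‖c‖ ≤ w * ‖c‖ := mul_le_mul_of_nonneg_right b3 (norm_nonneg _)
    have h4 : (T : ℝ) * ‖c‖ ≤ T * 3 := by nlinarith
    exact le_of_mul_le_mul_left h4 hTpos
  have b5 : ‖G.avg σ τ T - c‖ ≤ ε / 2 := by
    have e1 : G.avg σ τ T - c = (T : ℝ)⁻¹ • ((v - w • c) - ((T : ℝ) - w) • c) := by
      rw [sub_smul, sub_sub_sub_cancel_right, smul_sub, smul_smul, inv_mul_cancel₀ hTpos.ne',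
        one_smul]
      rfl
    rw [e1, norm_smul, norm_inv, Real.norm_of_nonneg hTpos.le, inv_mul_le_iff₀ hTpos]
    refine (norm_sub_le _ _).trans ?_
    rw [norm_smul, Real.norm_eq_abs]
    have h3 : |(T : ℝ) - w| * ‖c‖ ≤ (e * T) * 3 :=
      mul_le_mul b2 b4 (norm_nonneg _) (by positivity)
    nlinarith
  have b6 := Metric.infDist_le_infDist_add_dist (s := C) (x := G.avg σ τ T) (y := c)
  rw [dist_eq_norm] at b6
  have := (hCd c).1 hc
  linarith

end GQAux

open GQGame in
/-- In any generalized quitting game, if a closed convex set `C ⊆ ℝ^d`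
satisfies Condition (1), then `C` is weakly approachable by player 1. -/
theorem weaklyApproachable_of_cond1 {I J : Type} {d : ℕ}
    [Fintype I] [Fintype J] [Nonempty I] [Nonempty J]
    (G : GQGame I J d) (hg : ∀ i j, ‖G.g i j‖ ≤ 1)
    (C : Set (EuclideanSpace ℝ (Fin d))) (hC : IsClosed C) (hCconv : Convex ℝ C)
    (h1 : cond1Val G C = 0) :
    G.WeaklyApproachable1 C := by
  exact GQAux.main G hg C hCconv h1

end
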